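/- Macdonald eigenvalue problem of type A₁: for every n ≥ 0 the Rogers polynomial P_n satisfies (t^{1/2}X − t^{-1/2}X^{-1})·Γ(P_n) − (t^{1/2}X^{-1} − t^{-1/2}X)·Γ^{-1}(P_n) = (X − X^{-1})·(q^{n/2}t^{1/2} + q^{-n/2}t^{-1/2})·P_n, where Γ is the F-algebra automorphism of L with Γ(X) = q^{1/2}X (this is the Macdonald operator ℒ = ((t^{1/2}X−t^{-1/2}X^{-1})/(X−X^{-1}))Γ + ((t^{1/2}X^{-1}−t^{-1/2}X)/(X^{-1}−X))Γ^{-1} multiplied by X − X^{-1}). -/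

import Mathlib

/-!
Nonsymmetric Macdonald polynomials of type A₁: the explicit Laurent polynomials `E n`
are eigenfunctions of the Dunkl-type operator `Y` with eigenvalue `q^{-n_#}`.

The ground field is `F = ℚ(u,v)` with `q = u⁴`, `t = v²`; the Laurent polynomials
`F[X, X⁻¹]` are regarded inside the ambient field `M = F(X)`, in which all operators
are given by the same formulas (division by `X² - 1` is then unproblematic).
-/

noncomputable section

/-- The ground field `ℚ(u,v)`. -/
abbrev F : Type := RatFunc (RatFunc ℚ)

/-- `u`, with `q = u⁴` (so `u = q^{1/4}`). -/
def u : F := RatFunc.C RatFunc.X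

/-- `v`, with `t = v²` (so `v = t^{1/2}`). -/
def v : F := RatFunc.X

/-- `q = u⁴`. -/
def q : F := u ^ 4

/-- `t = v²`. -/
def t : F := v ^ 2

/-- The ambient field `F(X)` containing the Laurent polynomials `F[X,X⁻¹]`. -/
abbrev M : Type := RatFunc F

/-- The variable `X`. -/
def XM : M := RatFunc.X

/-- The involution `s : Xⁿ ↦ X⁻ⁿ` (the substitution `X ↦ X⁻¹`). -/
def sOp : M → M := RatFunc.eval RatFunc.C (XM⁻¹)

/-- The operator `π : Xⁿ ↦ q^{n/2} X⁻ⁿ` (the substitution `X ↦ q^{1/2} X⁻¹`). -/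
def piOp : M → M := RatFunc.eval RatFunc.C (RatFunc.C (u ^ 2) * XM⁻¹)

/-- The Demazure-Lusztig operator
`T(f) = t^{1/2}·s(f) + (t^{1/2} - t^{-1/2})·(s(f) - f)/(X² - 1)`. -/
def TOp (f : M) : M :=
  RatFunc.C v * sOp f + RatFunc.C (v - v⁻¹) * (sOp f - f) / (XM ^ 2 - 1)

/-- The operator `Y = π ∘ T`. -/
def YOp (f : M) : M := piOp (TOp f)

/-- The product `∏_{i=0}^{j-1} [(1-q^{n-i-1})(1-t qⁱ)]/[(1-q^{1+i})(1-t q^{n-i-1})]`. -/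
def macProdPos (n j : ℕ) : F :=
  ∏ i ∈ Finset.range j,
    ((1 - q ^ ((n : ℤ) - i - 1)) * (1 - t * q ^ (i : ℤ))) /
      ((1 - q ^ ((i : ℤ) + 1)) * (1 - t * q ^ ((n : ℤ) - i - 1)))

/-- The product `∏_{i=0}^{j-1} [(1-q^{n-i})(1-t qⁱ)]/[(1-q^{1+i})(1-t q^{n-i})]`. -/
def macProdNeg (n j : ℕ) : F :=
  ∏ i ∈ Finset.range j,
    ((1 - q ^ ((n : ℤ) - i)) * (1 - t * q ^ (i : ℤ))) /
      ((1 - q ^ ((i : ℤ) + 1)) * (1 - t * q ^ ((n : ℤ) - i)))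

/-- `E_n` for `n ≥ 1`. -/
def Epos (n : ℕ) : M :=
  XM ^ (n : ℤ)
    + ∑ j ∈ Finset.Icc 1 (n / 2),
        RatFunc.C (q ^ ((n : ℤ) - j) * (1 - q ^ (j : ℤ)) / (1 - q ^ ((n : ℤ) - j)) *
          macProdPos n j) * XM ^ (2 * (j : ℤ) - n)
    + ∑ j ∈ Finset.Icc 1 ((n - 1) / 2),
        RatFunc.C (q ^ (j : ℤ) * macProdPos n j) * XM ^ ((n : ℤ) - 2 * j)

/-- `E_{-n}` for `n ≥ 1`. -/
def Eneg (n : ℕ) : M :=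
  XM ^ (-(n : ℤ))
    + RatFunc.C ((1 - t) / (1 - t * q ^ (n : ℤ))) * XM ^ (n : ℤ)
    + ∑ j ∈ Finset.Icc 1 (n / 2),
        RatFunc.C (macProdNeg n j) * XM ^ (2 * (j : ℤ) - n)
    + ∑ j ∈ Finset.Icc 1 ((n - 1) / 2),
        RatFunc.C ((1 - t * q ^ (j : ℤ)) / (1 - t * q ^ ((n : ℤ) - j)) * macProdNeg n j) *
          XM ^ ((n : ℤ) - 2 * j)

/-- The nonsymmetric Macdonald polynomials `E_n`, `n ∈ ℤ`, given by the explicit formulas. -/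
def E : ℤ → M := fun n => if 0 < n then Epos n.toNat else if n = 0 then 1 else Eneg (-n).toNat

/-- The Rogers (symmetric Macdonald) polynomials:
`P_0 = 1` and `P_n = E_{-n} + (t(1-qⁿ)/(1-tqⁿ))·E_n` for `n ≥ 1`. -/
def P (n : ℕ) : M :=
  if n = 0 then 1
  else E (-(n : ℤ)) + RatFunc.C (t * (1 - q ^ (n : ℤ)) / (1 - t * q ^ (n : ℤ))) * E (n : ℤ)

/-- The `F`-algebra automorphism `Γ` of `L` with `Γ(X) = q^{1/2}X`. -/
def gam : M → M := RatFunc.eval RatFunc.C (RatFunc.C (u ^ 2) * XM)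

/-- The inverse automorphism `Γ⁻¹`, with `Γ⁻¹(X) = q^{-1/2}X`. -/
def gamInv : M → M := RatFunc.eval RatFunc.C (RatFunc.C ((u ^ 2)⁻¹) * XM)

lemma u_ne : u ≠ 0 := by
  unfold u
  exact (map_ne_zero _).2 RatFunc.X_ne_zero

lemma v_ne : v ≠ 0 := RatFunc.X_ne_zero

lemma XM_ne : XM ≠ 0 := RatFunc.X_ne_zero

lemma X_pow_ne_one {K : Type} [Field K] (k : ℕ) (hk : 0 < k) : (RatFunc.X : RatFunc K) ^ k ≠ 1 := by
  intro h
  have h2 : algebraMap (Polynomial K) (RatFunc K) (Polynomial.X ^ k) = algebraMap _ _ 1 := by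
    simpa using h
  have h3 := RatFunc.algebraMap_injective K h2
  have := congrArg Polynomial.natDegree h3
  simp at this
  omega

lemma one_sub_q (k : ℕ) : 1 - q ^ (k + 1) ≠ 0 := by
  intro h
  have h1 : q ^ (k + 1) = 1 := (sub_eq_zero.1 h).symm
  have h2 : RatFunc.C ((RatFunc.X : RatFunc ℚ) ^ (4 * (k + 1))) = (RatFunc.C 1 : F) := by
    rw [map_pow, map_one, pow_mul]
    exact h1
  exact X_pow_ne_one _ (by omega) (RatFunc.C_injective h2)

lemma one_sub_tq (k : ℤ) : 1 - t * q ^ k ≠ 0 := by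
  intro h
  have h1 : t * q ^ k = 1 := (sub_eq_zero.1 h).symm
  have h2 : t = RatFunc.C (((RatFunc.X : RatFunc ℚ) ^ 4) ^ (-k)) := by
    rw [map_zpow₀, map_pow, zpow_neg]
    exact eq_inv_of_mul_eq_one_left h1
  have h3 : algebraMap (Polynomial (RatFunc ℚ)) F (Polynomial.X ^ 2)
      = algebraMap _ _ (Polynomial.C (((RatFunc.X : RatFunc ℚ) ^ 4) ^ (-k))) := by
    rw [RatFunc.algebraMap_C, ← h2]
    simp [t, v]
  have h4 := congrArg Polynomial.natDegree (RatFunc.algebraMap_injective _ h3)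
  simp at h4

lemma eval2_ne (s : F) (hs : s ≠ 0) (p : Polynomial F) (hp : p ≠ 0) :
    Polynomial.eval₂ RatFunc.C (RatFunc.C s * XM) p ≠ 0 := by
  have h : Polynomial.eval₂ RatFunc.C (RatFunc.C s * XM) p
      = algebraMap _ M (p.comp (Polynomial.C s * Polynomial.X)) := by
    rw [Polynomial.comp, Polynomial.hom_eval₂]
    simp [XM]
  rw [h]
  intro h0
  have h1 : p.comp (Polynomial.C s * Polynomial.X) = 0 := by
    apply RatFunc.algebraMap_injective F
    rw [h0, map_zero]
  rcases Polynomial.comp_eq_zero_iff.1 h1 with h2 | ⟨_, h2⟩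
  · exact hp h2
  · have := congrArg Polynomial.natDegree h2
    rw [Polynomial.natDegree_C_mul_X _ hs, Polynomial.natDegree_C] at this
    omega

/-- The substitution `X ↦ sX` as a ring homomorphism. -/
def gHom (s : F) (hs : s ≠ 0) : M →+* M where
  toFun := RatFunc.eval RatFunc.C (RatFunc.C s * XM)
  map_one' := RatFunc.eval_one _ _
  map_zero' := RatFunc.eval_zero _ _
  map_add' x y := RatFunc.eval_add _ _ (eval2_ne s hs _ x.denom_ne_zero) (eval2_ne s hs _ y.denom_ne_zero)
  map_mul' x y := RatFunc.eval_mul _ _ (eval2_ne s hs _ x.denom_ne_zero) (eval2_ne s hs _ y.denom_ne_zero)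

lemma gHom_C (s : F) (hs : s ≠ 0) (c : F) : gHom s hs (RatFunc.C c) = RatFunc.C c :=
  RatFunc.eval_C _ _

lemma gHom_X (s : F) (hs : s ≠ 0) : gHom s hs XM = RatFunc.C s * XM :=
  RatFunc.eval_X _ _

lemma fld_add_one {K : Type} [Field K] (x : K) (hx : x ≠ 0) (m : ℤ) : x ^ (m + 1) = x ^ m * x :=
  zpow_add_one₀ hx m

lemma fld_sub_one {K : Type} [Field K] (x : K) (hx : x ≠ 0) (m : ℤ) : x ^ (m - 1) = x ^ m * x⁻¹ :=
  zpow_sub_one₀ hx m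

lemma fld_map {K L : Type} [Field K] [Field L] (f : K →+* L) (a : K) (m : ℤ) : f (a ^ m) = f a ^ m :=
  map_zpow₀ f a m

lemma fld_mul {K : Type} [Field K] (x y : K) (m : ℤ) : (x * y) ^ m = x ^ m * y ^ m :=
  mul_zpow x y m

lemma gHom_term (s : F) (hs : s ≠ 0) (c : F) (m : ℤ) :
    gHom s hs (RatFunc.C c * XM ^ m) = RatFunc.C (c * s ^ m) * XM ^ m := by
  have h : gHom s hs (XM ^ m) = RatFunc.C (s ^ m) * XM ^ m :=
    calc gHom s hs (XM ^ m) = (gHom s hs XM) ^ m := fld_map _ _ _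
      _ = (RatFunc.C s * XM) ^ m := by rw [gHom_X]
      _ = (RatFunc.C s) ^ m * XM ^ m := fld_mul (K := M) (RatFunc.C s) XM m
      _ = RatFunc.C (s ^ m) * XM ^ m := congrArg (· * XM ^ m) (fld_map RatFunc.C s m).symm
  rw [map_mul, gHom_C, h, map_mul, mul_assoc]

/-- Ratio of successive coefficients. -/
def rr (n i : ℕ) : F := ((1 - q ^ ((n : ℤ) - i)) * (1 - t * q ^ (i : ℤ))) /
      ((1 - q ^ ((i : ℤ) + 1)) * (1 - t * q ^ ((n : ℤ) - i - 1)))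

/-- Coefficients of the Rogers polynomials. -/
def cc (n j : ℕ) : F := ∏ i ∈ Finset.range j, rr n i

/-- Auxiliary products. -/
def BB (k : ℕ) : F := ∏ i ∈ Finset.range k, (1 - t * q ^ (i : ℤ)) / (1 - q ^ ((i : ℤ) + 1))

lemma one_sub_q' (k : ℤ) (hk : 0 < k) : 1 - q ^ k ≠ 0 := by
  obtain ⟨m, rfl⟩ : ∃ m : ℕ, k = ((m + 1 : ℕ) : ℤ) := ⟨k.toNat - 1, by omega⟩
  rw [zpow_natCast]
  exact one_sub_q m

lemma BB_ne (k : ℕ) : BB k ≠ 0 := by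
  unfold BB
  rw [Finset.prod_ne_zero_iff]
  intro i _
  exact div_ne_zero (one_sub_tq _) (one_sub_q' _ (by omega))

lemma cc_BB (j m : ℕ) : cc (j + m) j * BB (j + m) = BB j * BB m := by
  suffices h : ∀ n j m, j + m = n → cc n j * BB n = BB j * BB m from h _ j m rfl
  intro n j
  induction j with
  | zero =>
    intro m h
    obtain rfl : m = n := by omega
    simp [cc, BB]
  | succ j ih =>
    intro m h
    have h1 := ih (m + 1) (by omega)
    have e1 : cc n (j + 1) = cc n j * rr n j := Finset.prod_range_succ _ _
    have e2 : BB (j + 1) = BB j * ((1 - t * q ^ (j : ℤ)) / (1 - q ^ ((j : ℤ) + 1))) :=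
      Finset.prod_range_succ _ _
    have e3 : BB (m + 1) = BB m * ((1 - t * q ^ (m : ℤ)) / (1 - q ^ ((m : ℤ) + 1))) :=
      Finset.prod_range_succ _ _
    have e4 : rr n j = ((1 - q ^ ((m : ℤ) + 1)) * (1 - t * q ^ (j : ℤ))) /
      ((1 - q ^ ((j : ℤ) + 1)) * (1 - t * q ^ (m : ℤ))) := by
      unfold rr
      have a : (n : ℤ) - j = m + 1 := by omega
      have b : (n : ℤ) - j - 1 = m := by omega
      rw [b, a]
    rw [e1, e2, mul_right_comm, h1, e3, e4]
    have n1 := one_sub_tq (m : ℤ)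
    have n2 := one_sub_q' ((m : ℤ) + 1) (by omega)
    have n3 := one_sub_q' ((j : ℤ) + 1) (by omega)
    generalize (1 - t * q ^ (m : ℤ)) = A at *
    generalize (1 - t * q ^ (j : ℤ)) = B at *
    generalize (1 - q ^ ((m : ℤ) + 1)) = C at *
    generalize (1 - q ^ ((j : ℤ) + 1)) = D at *
    field_simp

lemma cc_symm (j m : ℕ) : cc (j + m) j = cc (j + m) m := by
  have h1 := cc_BB j m
  have h2 := cc_BB m j
  rw [add_comm m j, mul_comm (BB m), ← h1] at h2
  exact (mul_right_cancel₀ (BB_ne _) h2).symm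

lemma neg_cc (n j : ℕ) :
    macProdNeg n j * (1 - t * q ^ (n : ℤ)) = cc n j * (1 - t * q ^ ((n : ℤ) - j)) := by
  induction j with
  | zero => simp [macProdNeg, cc]
  | succ j ih =>
    have e1 : cc n (j + 1) = cc n j * rr n j := Finset.prod_range_succ _ _
    have e2 : macProdNeg n (j + 1) = macProdNeg n j * (((1 - q ^ ((n : ℤ) - j)) * (1 - t * q ^ (j : ℤ))) /
      ((1 - q ^ ((j : ℤ) + 1)) * (1 - t * q ^ ((n : ℤ) - j)))) := Finset.prod_range_succ _ _
    rw [e1, e2, mul_right_comm, ih, rr]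
    have a : (n : ℤ) - (j + 1 : ℕ) = (n : ℤ) - j - 1 := by push_cast; ring
    rw [a]
    have n1 := one_sub_tq ((n : ℤ) - j)
    have n2 := one_sub_tq ((n : ℤ) - j - 1)
    have n3 := one_sub_q' ((j : ℤ) + 1) (by omega)
    generalize (1 - t * q ^ ((n : ℤ) - j)) = A at *
    generalize (1 - t * q ^ ((n : ℤ) - j - 1)) = B at *
    generalize (1 - q ^ ((j : ℤ) + 1)) = D at *
    field_simp

lemma pos_neg (n j : ℕ) (hj : j < n) :
    macProdPos n j * ((1 - q ^ (n : ℤ)) * (1 - t * q ^ ((n : ℤ) - j)))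
      = macProdNeg n j * ((1 - q ^ ((n : ℤ) - j)) * (1 - t * q ^ (n : ℤ))) := by
  induction j with
  | zero => simp [macProdNeg, macProdPos]
  | succ j ih =>
    have ih := ih (by omega)
    have e1 : macProdPos n (j + 1) = macProdPos n j * (((1 - q ^ ((n : ℤ) - j - 1)) * (1 - t * q ^ (j : ℤ))) /
      ((1 - q ^ ((j : ℤ) + 1)) * (1 - t * q ^ ((n : ℤ) - j - 1)))) := Finset.prod_range_succ _ _
    have e2 : macProdNeg n (j + 1) = macProdNeg n j * (((1 - q ^ ((n : ℤ) - j)) * (1 - t * q ^ (j : ℤ))) /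
      ((1 - q ^ ((j : ℤ) + 1)) * (1 - t * q ^ ((n : ℤ) - j)))) := Finset.prod_range_succ _ _
    have a : (n : ℤ) - (j + 1 : ℕ) = (n : ℤ) - j - 1 := by push_cast; ring
    rw [e1, e2, a]
    have n1 := one_sub_tq ((n : ℤ) - j)
    have n2 := one_sub_tq ((n : ℤ) - j - 1)
    have n3 := one_sub_q' ((j : ℤ) + 1) (by omega)
    generalize (1 - t * q ^ ((n : ℤ) - j)) = A at *
    generalize (1 - t * q ^ ((n : ℤ) - j - 1)) = B at *
    generalize (1 - q ^ ((j : ℤ) + 1)) = D at *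
    generalize (1 - q ^ ((n : ℤ) - j)) = G at *
    generalize (1 - q ^ ((n : ℤ) - j - 1)) = H at *
    generalize (1 - t * q ^ (j : ℤ)) = I at *
    field_simp
    linear_combination H * I * ih

lemma alg1 {K : Type} [Field K] (N Q c t A B y x : K) (hx : 1 - t * x ≠ 0) (hn : 1 - t * (x * y) ≠ 0)
    (hq : 1 - x * y ≠ 0) (hx' : 1 - x ≠ 0)
    (h1 : N * (1 - t * (x * y)) = c * (1 - t * x))
    (h2 : Q * ((1 - x * y) * (1 - t * x)) = N * ((1 - x) * (1 - t * (x * y)))) :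
    N + t * (1 - x * y) / (1 - t * (x * y)) * (x * (1 - y) / (1 - x) * Q) = c ∧
    (1 - t * y) / (1 - t * x) * N + t * (1 - x * y) / (1 - t * (x * y)) * (y * Q) = c := by
  have hc : c = N * (1 - t * (x * y)) / (1 - t * x) := by
    rw [eq_div_iff hx, h1]
  have hQ : Q = N * ((1 - x) * (1 - t * (x * y))) / ((1 - x * y) * (1 - t * x)) := by
    rw [eq_div_iff (mul_ne_zero hq hx), h2]
  rw [hc, hQ]
  generalize hA : 1 - t * x = A' at *
  generalize hB : 1 - t * (x * y) = B' at *
  generalize hC : 1 - x * y = C' at *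
  generalize hD : 1 - x = D' at *
  constructor
  · field_simp
    rw [← hA, ← hB]
    ring
  · field_simp
    rw [← hB, ← hD]
    ring

lemma q_ne : q ≠ 0 := pow_ne_zero _ u_ne

lemma coef (n j : ℕ) (hj : j < n) :
    macProdNeg n j + t * (1 - q ^ (n : ℤ)) / (1 - t * q ^ (n : ℤ)) *
      (q ^ ((n : ℤ) - j) * (1 - q ^ (j : ℤ)) / (1 - q ^ ((n : ℤ) - j)) * macProdPos n j) = cc n j ∧
    (1 - t * q ^ (j : ℤ)) / (1 - t * q ^ ((n : ℤ) - j)) * macProdNeg n j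
      + t * (1 - q ^ (n : ℤ)) / (1 - t * q ^ (n : ℤ)) * (q ^ (j : ℤ) * macProdPos n j) = cc n j := by
  have e : q ^ (n : ℤ) = q ^ ((n : ℤ) - j) * q ^ (j : ℤ) := by
    rw [← zpow_add₀ q_ne]
    congr 1
    ring
  have h1 := neg_cc n j
  have h2 := pos_neg n j hj
  have n1 := one_sub_tq ((n : ℤ) - j)
  have n2 := one_sub_tq (n : ℤ)
  have n3 := one_sub_q' (n : ℤ) (by omega)
  have n4 := one_sub_q' ((n : ℤ) - j) (by omega)
  rw [e] at h1 h2 n2 n3 ⊢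
  exact alg1 _ _ _ _ 0 0 _ _ n1 n2 n3 n4 h1 h2

lemma cc_zero (n : ℕ) : cc n 0 = 1 := by simp [cc]

lemma cc_self (n : ℕ) : cc n n = 1 := by
  have := cc_symm n 0
  rw [add_zero] at this
  rw [this, cc_zero]

lemma P_eq (n : ℕ) :
    P n = ∑ j ∈ Finset.range (n + 1), RatFunc.C (cc n j) * XM ^ ((n : ℤ) - 2 * j) := by
  rcases Nat.eq_zero_or_pos n with rfl | hn
  · simp [P, cc]
  have hE1 : E (n : ℤ) = Epos n := by
    simp [E, hn]
  have hE2 : E (-(n : ℤ)) = Eneg n := by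
    have : ¬ (n : ℤ) < 0 := by omega
    simp [E, this, hn.ne']
  rw [P, if_neg hn.ne', hE1, hE2, Epos, Eneg]
  have hs : ∑ j ∈ Finset.range (n + 1), RatFunc.C (cc n j) * XM ^ ((n : ℤ) - 2 * j)
      = XM ^ (n : ℤ) + XM ^ (-(n : ℤ))
        + ∑ j ∈ Finset.Icc 1 (n / 2), RatFunc.C (cc n j) * XM ^ (2 * (j : ℤ) - n)
        + ∑ j ∈ Finset.Icc 1 ((n - 1) / 2), RatFunc.C (cc n j) * XM ^ ((n : ℤ) - 2 * j) := by
    have r : ∑ j ∈ Finset.Icc 1 (n / 2), RatFunc.C (cc n j) * XM ^ (2 * (j : ℤ) - n)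
        = ∑ j ∈ Finset.Ico ((n - 1) / 2 + 1) n, RatFunc.C (cc n j) * XM ^ ((n : ℤ) - 2 * j) := by
      refine Finset.sum_bij' (fun j _ => n - j) (fun j _ => n - j) ?_ ?_ ?_ ?_ ?_
      · intro j hj
        simp only [Finset.mem_Icc, Finset.mem_Ico] at *
        omega
      · intro j hj
        simp only [Finset.mem_Icc, Finset.mem_Ico] at *
        omega
      · intro j hj
        simp only [Finset.mem_Icc, Finset.mem_Ico] at *
        omega
      · intro j hj
        simp only [Finset.mem_Icc, Finset.mem_Ico] at *
        omega
      · intro j hj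
        simp only [Finset.mem_Icc] at hj
        obtain ⟨m, rfl⟩ : ∃ m, n = j + m := ⟨n - j, by omega⟩
        rw [Nat.add_sub_cancel_left, cc_symm]
        congr 2
        push_cast
        ring
    have i1 : Finset.Icc 1 ((n - 1) / 2) = Finset.Ico 1 ((n - 1) / 2 + 1) := by
      ext j
      simp only [Finset.mem_Icc, Finset.mem_Ico]
      omega
    rw [r, i1, add_assoc, add_comm (∑ j ∈ Finset.Ico ((n - 1) / 2 + 1) n, _),
      Finset.sum_Ico_consecutive _ (by omega) (by omega), Finset.sum_range_succ, Finset.range_eq_Ico,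
      Finset.sum_eq_sum_Ico_succ_bot hn, cc_self, cc_zero]
    have : (n : ℤ) - 2 * n = -n := by ring
    rw [this]
    simp
    ring
  rw [hs]
  have s1 : ∀ j ∈ Finset.Icc 1 (n / 2), RatFunc.C (cc n j) * XM ^ (2 * (j : ℤ) - n)
      = RatFunc.C (macProdNeg n j) * XM ^ (2 * (j : ℤ) - n)
        + RatFunc.C (t * (1 - q ^ (n : ℤ)) / (1 - t * q ^ (n : ℤ))) *
          (RatFunc.C (q ^ ((n : ℤ) - j) * (1 - q ^ (j : ℤ)) / (1 - q ^ ((n : ℤ) - j)) *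
          macProdPos n j) * XM ^ (2 * (j : ℤ) - n)) := by
    intro j hj
    rw [Finset.mem_Icc] at hj
    rw [← mul_assoc, ← map_mul, ← add_mul, ← map_add, (coef n j (by omega)).1]
  have s2 : ∀ j ∈ Finset.Icc 1 ((n - 1) / 2), RatFunc.C (cc n j) * XM ^ ((n : ℤ) - 2 * j)
      = RatFunc.C ((1 - t * q ^ (j : ℤ)) / (1 - t * q ^ ((n : ℤ) - j)) * macProdNeg n j) *
          XM ^ ((n : ℤ) - 2 * j)
        + RatFunc.C (t * (1 - q ^ (n : ℤ)) / (1 - t * q ^ (n : ℤ))) *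
          (RatFunc.C (q ^ (j : ℤ) * macProdPos n j) * XM ^ ((n : ℤ) - 2 * j)) := by
    intro j hj
    rw [Finset.mem_Icc] at hj
    rw [← mul_assoc, ← map_mul, ← add_mul, ← map_add, (coef n j (by omega)).2]
  rw [Finset.sum_congr rfl s1, Finset.sum_congr rfl s2, Finset.sum_add_distrib,
    Finset.sum_add_distrib, ← Finset.mul_sum, ← Finset.mul_sum]
  have h0 : RatFunc.C ((1 - t) / (1 - t * q ^ (n : ℤ)))
      + RatFunc.C (t * (1 - q ^ (n : ℤ)) / (1 - t * q ^ (n : ℤ))) = (1 : M) := by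
    rw [← map_add, ← add_div]
    have : (1 - t + t * (1 - q ^ (n : ℤ))) / (1 - t * q ^ (n : ℤ)) = 1 := by
      rw [div_eq_one_iff_eq (one_sub_tq _)]
      ring
    rw [this, map_one]
  linear_combination XM ^ (n : ℤ) * h0

lemma alg2 {K : Type} [Field K] (v s z w c : K) (hv : v ≠ 0) (hs : s ≠ 0) (hz : z ≠ 0) (hw : w ≠ 0)
    (h1 : 1 - z ^ 2 * s ^ 2 ≠ 0) (h2 : 1 - v ^ 2 * (w ^ 2 / (z ^ 2 * s ^ 2)) ≠ 0) :
    c * (((1 - w ^ 2 / z ^ 2) * (1 - v ^ 2 * z ^ 2)) /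
      ((1 - z ^ 2 * s ^ 2) * (1 - v ^ 2 * (w ^ 2 / (z ^ 2 * s ^ 2))))) *
      (v * (w / (z ^ 2 * s ^ 2)) + v⁻¹ * (w / (z ^ 2 * s ^ 2))⁻¹ - (w * v + w⁻¹ * v⁻¹))
    = c * (v⁻¹ * (w / z ^ 2) + v * (w / z ^ 2)⁻¹ - (w * v + w⁻¹ * v⁻¹)) := by
  have h3 : z ^ 2 * s ^ 2 - v ^ 2 * w ^ 2 ≠ 0 := by
    intro h
    apply h2
    field_simp
    rw [mul_zero]
    exact h
  have e : 1 - v ^ 2 * (w ^ 2 / (z ^ 2 * s ^ 2)) = (z ^ 2 * s ^ 2 - v ^ 2 * w ^ 2) / (z ^ 2 * s ^ 2) := by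
    field_simp
  rw [e]
  generalize hA : z ^ 2 * s ^ 2 - v ^ 2 * w ^ 2 = A' at *
  generalize hB : 1 - z ^ 2 * s ^ 2 = B' at *
  field_simp
  rw [← hA, ← hB]
  ring

lemma rec_cc (n j : ℕ) :
    cc n (j + 1) * (v * (u ^ 2) ^ ((n : ℤ) - 2 * (j + 1 : ℕ))
      + v⁻¹ * ((u ^ 2) ^ ((n : ℤ) - 2 * (j + 1 : ℕ)))⁻¹
      - ((u ^ 2) ^ (n : ℤ) * v + ((u ^ 2) ^ (n : ℤ))⁻¹ * v⁻¹))
    = cc n j * (v⁻¹ * (u ^ 2) ^ ((n : ℤ) - 2 * j) + v * ((u ^ 2) ^ ((n : ℤ) - 2 * j))⁻¹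
      - ((u ^ 2) ^ (n : ℤ) * v + ((u ^ 2) ^ (n : ℤ))⁻¹ * v⁻¹)) := by
  have hs : u ^ 2 ≠ 0 := pow_ne_zero _ u_ne
  have e1 : cc n (j + 1) = cc n j * rr n j := Finset.prod_range_succ _ _
  have hq : q = (u ^ 2) ^ 2 := by
    rw [q]
    ring
  have p1 : q ^ ((n : ℤ) - j) = ((u ^ 2) ^ (n : ℤ)) ^ 2 / ((u ^ 2) ^ (j : ℤ)) ^ 2 := by
    rw [zpow_sub₀ q_ne, hq]
    simp only [zpow_natCast]
    ring
  have p2 : q ^ (j : ℤ) = ((u ^ 2) ^ (j : ℤ)) ^ 2 := by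
    rw [hq]
    simp only [zpow_natCast]
    ring
  have p3 : q ^ ((j : ℤ) + 1) = ((u ^ 2) ^ (j : ℤ)) ^ 2 * (u ^ 2) ^ 2 := by
    rw [zpow_add₀ q_ne, p2, zpow_one, hq]
  have p4 : q ^ ((n : ℤ) - j - 1) = ((u ^ 2) ^ (n : ℤ)) ^ 2 / (((u ^ 2) ^ (j : ℤ)) ^ 2 * (u ^ 2) ^ 2) := by
    rw [zpow_sub₀ q_ne, p1, zpow_one, hq, div_div]
  have p5 : (u ^ 2) ^ ((n : ℤ) - 2 * j) = (u ^ 2) ^ (n : ℤ) / ((u ^ 2) ^ (j : ℤ)) ^ 2 := by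
    rw [zpow_sub₀ hs, mul_comm, zpow_mul]
    rfl
  have p6 : (u ^ 2) ^ ((n : ℤ) - 2 * (j + 1 : ℕ))
      = (u ^ 2) ^ (n : ℤ) / (((u ^ 2) ^ (j : ℤ)) ^ 2 * (u ^ 2) ^ 2) := by
    have : (n : ℤ) - 2 * (j + 1 : ℕ) = (n : ℤ) - 2 * j - 2 := by
      push_cast
      ring
    rw [this, zpow_sub₀ hs, p5, div_div]
    rfl
  have n1 := one_sub_q' ((j : ℤ) + 1) (by omega)
  have n2 := one_sub_tq ((n : ℤ) - j - 1)
  rw [p3] at n1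
  rw [p4] at n2
  rw [e1, rr, p1, p2, p3, p4, p5, p6]
  exact alg2 v (u ^ 2) _ _ _ v_ne hs (zpow_ne_zero _ hs) (zpow_ne_zero _ hs) n1 n2

/-- Macdonald eigenvalue problem of type `A₁`: for every `n ≥ 0`,
`(t^{1/2}X - t^{-1/2}X⁻¹)·Γ(P_n) - (t^{1/2}X⁻¹ - t^{-1/2}X)·Γ⁻¹(P_n)
  = (X - X⁻¹)·(q^{n/2}t^{1/2} + q^{-n/2}t^{-1/2})·P_n`,
i.e. the Macdonald operator `ℒ` multiplied by `X - X⁻¹` acts on `P_n` with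
eigenvalue `q^{n/2}t^{1/2} + q^{-n/2}t^{-1/2}`. -/
theorem macdonald_operator_eigenvalue (n : ℕ) :
    (RatFunc.C v * XM - RatFunc.C v⁻¹ * XM⁻¹) * gam (P n)
      - (RatFunc.C v * XM⁻¹ - RatFunc.C v⁻¹ * XM) * gamInv (P n)
    = (XM - XM⁻¹) * RatFunc.C ((u ^ 2) ^ (n : ℤ) * v + ((u ^ 2) ^ (n : ℤ))⁻¹ * v⁻¹) * P n := by
  have hs : u ^ 2 ≠ 0 := pow_ne_zero _ u_ne
  have g1 : gam (P n) = gHom (u ^ 2) hs (P n) := rfl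
  have g2 : gamInv (P n) = gHom ((u ^ 2)⁻¹) (inv_ne_zero hs) (P n) := rfl
  rw [g1, g2, P_eq, map_sum, map_sum]
  simp only [gHom_term]
  set lam : F := (u ^ 2) ^ (n : ℤ) * v + ((u ^ 2) ^ (n : ℤ))⁻¹ * v⁻¹ with hlam
  set g : ℕ → M := fun j => RatFunc.C (cc n j * (v * (u ^ 2) ^ ((n : ℤ) - 2 * j)
      + v⁻¹ * ((u ^ 2) ^ ((n : ℤ) - 2 * j))⁻¹ - lam)) * XM ^ ((n : ℤ) - 2 * j + 1) with hg
  have key : ∑ j ∈ Finset.range (n + 1), (g j - g (j + 1)) = 0 := by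
    rw [Finset.sum_range_sub']
    have z0 : g 0 = 0 := by
      have : v * (u ^ 2) ^ ((n : ℤ) - 2 * (0 : ℕ)) + v⁻¹ * ((u ^ 2) ^ ((n : ℤ) - 2 * (0 : ℕ)))⁻¹ - lam = 0 := by
        rw [hlam]
        simp only [Nat.cast_zero, mul_zero, sub_zero]
        ring
      simp only [hg]
      rw [this]
      simp
    have z1 : g (n + 1) = 0 := by
      have : cc n (n + 1) = 0 := by
        rw [cc, Finset.prod_range_succ, rr]
        simp
      simp only [hg]
      rw [this]
      simp
    rw [z0, z1, sub_zero]
  rw [← sub_eq_zero, ← key, Finset.mul_sum, Finset.mul_sum, Finset.mul_sum,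
    ← Finset.sum_sub_distrib, ← Finset.sum_sub_distrib]
  refine Finset.sum_congr rfl fun j _ => ?_
  have r := rec_cc n j
  rw [← hlam] at r
  simp only [hg]
  rw [r]
  have x1 : XM ^ ((n : ℤ) - 2 * j + 1) = XM ^ ((n : ℤ) - 2 * j) * XM :=
    fld_add_one XM XM_ne _
  have x2 : XM ^ ((n : ℤ) - 2 * (j + 1 : ℕ) + 1) = XM ^ ((n : ℤ) - 2 * j) * XM⁻¹ := by
    have e : (n : ℤ) - 2 * (j + 1 : ℕ) + 1 = (n : ℤ) - 2 * j - 1 := by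
      push_cast
      ring
    rw [e]
    exact fld_sub_one XM XM_ne _
  rw [x1, x2, inv_zpow]
  simp only [map_mul, map_sub, map_add]
  ring
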